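/- Let (Λ,η) be an isothermic surface in S³, fix a nonzero w ∈ ℝ^{4,1}, and let F : Σ → E(w) be the lift of Λ with conformal curvature line coordinates (u,v) corresponding to η, conformal factor e^{2θ} and principal curvatures k₁, k₂; set H = (k₁+k₂)/2, L = e^{2θ}(k₁−k₂), M = −HL. Then (Λ,η) is special isothermic of type 2 in E(w) if and only if there exist real constants A, B, C such that both H_{uu} + θ_u H_u − θ_v H_v − (1/2)Mk₁ − Ak₁ − Be^{−2θ} + C − (1/2)L(w,w) = 0 and H_{vv} − θ_u H_u + θ_v H_v + (1/2)Mk₂ + Ak₂ − Be^{−2θ} − C + (1/2)L(w,w) = 0 hold on Σ. -/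

import Mathlib

noncomputable section

open Finset

/-- Minkowski space `ℝ^{n+1,1}`, modelled on `Fin (n+2) → ℝ`. -/
abbrev MV (n : ℕ) : Type := EuclideanSpace ℝ (Fin (n + 2))

/-- The Minkowski inner product of signature `(n+1,1)`. -/
def mink (n : ℕ) (x y : MV n) : ℝ :=
  ∑ i : Fin (n + 1), x i.castSucc * y i.castSucc
    - x (Fin.last (n + 1)) * y (Fin.last (n + 1))

/-- The light cone `L ⊂ ℝ^{n+1,1}`. -/
def LightCone (n : ℕ) : Set (MV n) := {v | v ≠ 0 ∧ mink n v v = 0}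

/-- The skew endomorphism `u ∧ v`, acting by `(u ∧ v) w = (u,w)v − (v,w)u`. -/
def wedge (n : ℕ) (u v w : MV n) : MV n :=
  mink n u w • v - mink n v w • u

/-- The surface domain: a two-dimensional coordinate chart. -/
abbrev Surf : Type := ℝ × ℝ

/-- the coordinate direction ∂/∂u -/
def du : Surf := (1, 0)

/-- the coordinate direction ∂/∂v -/
def dv : Surf := (0, 1)

/-- partial derivative of a section in a coordinate direction -/
def pd {n : ℕ} (e : Surf) (f : Surf → MV n) (x : Surf) : MV n :=
  fderiv ℝ f x e

lemma mink_add_left (n : ℕ) (a b c : MV n) :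
    mink n (a + b) c = mink n a c + mink n b c := by
  simp [mink, PiLp.add_apply, add_mul, Finset.sum_add_distrib]; ring

lemma mink_smul_left (n : ℕ) (r : ℝ) (a c : MV n) :
    mink n (r • a) c = r * mink n a c := by
  simp [mink, PiLp.smul_apply, smul_eq_mul, mul_sub, Finset.mul_sum, mul_assoc]

lemma mink_zero_left (n : ℕ) (c : MV n) : mink n 0 c = 0 := by
  simp [mink]

/-- An isothermic surface `(Λ,η)` in `S^n = P(L)`, given by a nowhere-zero null
lift `F` of the immersion `Λ` together with the 1-form
`η = F ∧ W₁ du + F ∧ W₂ dv` with values in `Λ ∧ Λ^⊥`. -/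
structure IsothermicSurface (n : ℕ) : Type where
  F : Surf → MV n
  W₁ : Surf → MV n
  W₂ : Surf → MV n
  smooth_F : ContDiff ℝ (⊤ : ℕ∞) F
  smooth_W₁ : ContDiff ℝ (⊤ : ℕ∞) W₁
  smooth_W₂ : ContDiff ℝ (⊤ : ℕ∞) W₂
  F_ne : ∀ x, F x ≠ 0
  F_null : ∀ x, mink n (F x) (F x) = 0
  immersed : ∀ x, LinearIndependent ℝ ![F x, pd du F x, pd dv F x]
  W₁_perp : ∀ x, mink n (F x) (W₁ x) = 0
  W₂_perp : ∀ x, mink n (F x) (W₂ x) = 0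
  eta_ne : ∃ x z, wedge n (F x) (W₁ x) z ≠ 0 ∨ wedge n (F x) (W₂ x) z ≠ 0
  eta_closed : ∀ x z,
    fderiv ℝ (fun y => wedge n (F y) (W₂ y) z) x du
      = fderiv ℝ (fun y => wedge n (F y) (W₁ y) z) x dv

/-- `s` is a parallel section for the flat connection `∇^t = d + tη`. -/
def ParallelSection (n : ℕ) (S : IsothermicSurface n) (t : ℝ)
    (s : Surf → MV n) : Prop :=
  ∀ x, fderiv ℝ s x du + t • wedge n (S.F x) (S.W₁ x) (s x) = 0
     ∧ fderiv ℝ s x dv + t • wedge n (S.F x) (S.W₂ x) (s x) = 0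

/-- A polynomial conserved quantity of degree `d` of the isothermic surface
`(Λ,η)`: a polynomial `p(t) = Σ_{k=0}^d p_k t^k` of (smooth) sections, of exact
degree `d`, with `∇^t p(t) = 0` for all `t`. -/
structure PolyConservedQuantity (n : ℕ) (S : IsothermicSurface n) (d : ℕ) : Type where
  coeff : ℕ → Surf → MV n
  smooth : ∀ k, ContDiff ℝ (⊤ : ℕ∞) (coeff k)
  coeff_eq_zero : ∀ k, d < k → coeff k = 0
  top_ne : coeff d ≠ 0
  conserved : ∀ t : ℝ, ParallelSection n S t
    (fun x => ∑ k ∈ Finset.range (d + 1), t ^ k • coeff k x)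

/-- evaluation `p(t)` of a polynomial conserved quantity -/
def pcEval {n : ℕ} {S : IsothermicSurface n} {d : ℕ}
    (p : PolyConservedQuantity n S d) (t : ℝ) (x : Surf) : MV n :=
  ∑ k ∈ Finset.range (d + 1), t ^ k • p.coeff k x

/-- `(Λ,η)` is a special isothermic surface of type `d`. -/
def SpecialOfType (n : ℕ) (S : IsothermicSurface n) (d : ℕ) : Prop :=
  Nonempty (PolyConservedQuantity n S d)

/-- `p₀ ∈ ⟨w⟩`: the polynomial conserved quantity exhibits `(Λ,η)` as special
isothermic in the space-form `E(w)`. -/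
def InSpaceForm {n : ℕ} {S : IsothermicSurface n} {d : ℕ}
    (p : PolyConservedQuantity n S d) (w : MV n) : Prop :=
  ∃ c : ℝ, ∀ x, p.coeff 0 x = c • w

/-- fullness: the image of `Λ` lies in no proper subsphere -/
def Full (n : ℕ) (S : IsothermicSurface n) : Prop :=
  ¬ ∃ p : MV n, p ≠ 0 ∧ ∀ x, mink n p (S.F x) = 0
/-- A Darboux transform `Λ̂` of `(Λ,η)` with parameter `m`, given by a
`∇^m`-parallel null lift `G` spanning an immersed surface with `Λ̂ ∩ Λ = 0`. -/
structure DarbouxTransform (n : ℕ) (S : IsothermicSurface n) (m : ℝ) : Type where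
  G : Surf → MV n
  smooth_G : ContDiff ℝ (⊤ : ℕ∞) G
  G_ne : ∀ x, G x ≠ 0
  G_null : ∀ x, mink n (G x) (G x) = 0
  immersed : ∀ x, LinearIndependent ℝ ![G x, pd du G x, pd dv G x]
  disjoint : ∀ x, G x ∉ Submodule.span ℝ {S.F x}
  parallel : ParallelSection n S m G

/-- The gauge transformation `Γ_{⟨F⟩}^{⟨G⟩}(c)`: acts as `c` on `⟨G⟩`, as `1` on
`(⟨F⟩ ⊕ ⟨G⟩)^⊥` and as `c⁻¹` on `⟨F⟩`. -/
def gaugeG (n : ℕ) (F G : MV n) (c : ℝ) (z : MV n) : MV n :=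
  ((mink n G z / mink n F G) / c) • F
    + (c * (mink n F z / mink n F G)) • G
    + (z - (mink n G z / mink n F G) • F - (mink n F z / mink n F G) • G)

/-- `Γ_Λ^{Λ̂}(1 − t/m) · (d + tη) = d + tη̂` for all `t ≠ m`: the gauge relation
between the pencils of flat connections of an isothermic surface `S` and of (an
isothermic structure `T` on) its Darboux transform with parameter `m`. -/
def GaugeRel (n : ℕ) (S T : IsothermicSurface n) (m : ℝ) : Prop :=
  ∀ t : ℝ, t ≠ m → ∀ s : Surf → MV n, ContDiff ℝ (⊤ : ℕ∞) s → ∀ x : Surf,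
    (fderiv ℝ (fun y => gaugeG n (S.F y) (T.F y) (1 - t / m) (s y)) x du
        + t • wedge n (T.F x) (T.W₁ x) (gaugeG n (S.F x) (T.F x) (1 - t / m) (s x))
      = gaugeG n (S.F x) (T.F x) (1 - t / m)
          (fderiv ℝ s x du + t • wedge n (S.F x) (S.W₁ x) (s x)))
    ∧ (fderiv ℝ (fun y => gaugeG n (S.F y) (T.F y) (1 - t / m) (s y)) x dv
        + t • wedge n (T.F x) (T.W₂ x) (gaugeG n (S.F x) (T.F x) (1 - t / m) (s x))
      = gaugeG n (S.F x) (T.F x) (1 - t / m)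
          (fderiv ℝ s x dv + t • wedge n (S.F x) (S.W₂ x) (s x)))

/-- `Λ̂ = ⟨p(m)⟩` with `(p(m),p(m)) = 0`: the Darboux transform `D` is a
complementary surface of `(Λ,η)` with respect to `p(t)`. -/
def IsComplementary (n : ℕ) {S : IsothermicSurface n} {d : ℕ}
    (p : PolyConservedQuantity n S d) {m : ℝ} (D : DarbouxTransform n S m) : Prop :=
  (∀ x, mink n (pcEval p m x) (pcEval p m x) = 0) ∧
  (∀ x, Submodule.span ℝ {D.G x} = Submodule.span ℝ {pcEval p m x})

/-- `m` is a repeated root of the (constant-coefficient) polynomial `(p(t),p(t))`. -/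
def IsRepeatedRootAt {n : ℕ} {S : IsothermicSurface n} {d : ℕ}
    (p : PolyConservedQuantity n S d) (m : ℝ) : Prop :=
  ∀ x, mink n (pcEval p m x) (pcEval p m x) = 0
    ∧ deriv (fun t : ℝ => mink n (pcEval p t x) (pcEval p t x)) m = 0
/-- metric coefficient `g₁₁ = (F_u,F_u)` of the induced metric -/
def gUU (n : ℕ) (F : Surf → MV n) (x : Surf) : ℝ := mink n (pd du F x) (pd du F x)

/-- metric coefficient `g₁₂ = (F_u,F_v)` -/
def gUV (n : ℕ) (F : Surf → MV n) (x : Surf) : ℝ := mink n (pd du F x) (pd dv F x)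

/-- metric coefficient `g₂₂ = (F_v,F_v)` -/
def gVV (n : ℕ) (F : Surf → MV n) (x : Surf) : ℝ := mink n (pd dv F x) (pd dv F x)

/-- `(𝐇, N)`, the inner product of the mean curvature vector of `F` (in a
space-form `E(w)`) with a normal field `N`: half the trace with respect to the
induced metric of the `N`-component of the second fundamental form. -/
def meanCurv (n : ℕ) (F N : Surf → MV n) (x : Surf) : ℝ :=
  (gVV n F x * mink n (pd du (pd du F) x) (N x)
    - 2 * gUV n F x * mink n (pd du (pd dv F) x) (N x)
    + gUU n F x * mink n (pd dv (pd dv F) x) (N x))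
  / (2 * (gUU n F x * gVV n F x - gUV n F x ^ 2))

/-- `N` is a unit normal field of the lift `F : Σ → E(w)`. -/
def IsUnitNormal (n : ℕ) (F N : Surf → MV n) (w : MV n) : Prop :=
  (∀ x, mink n (N x) (N x) = 1) ∧ (∀ x, mink n (N x) w = 0)
    ∧ (∀ x, mink n (N x) (F x) = 0)
    ∧ (∀ x, mink n (N x) (pd du F x) = 0) ∧ (∀ x, mink n (N x) (pd dv F x) = 0)

/-- `N` is parallel for the normal connection of `F : Σ → E(w)`: the derivative
of `N` has no component in the normal bundle of `F` in `E(w)`. -/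
def ParallelNormal (n : ℕ) (F N : Surf → MV n) (w : MV n) : Prop :=
  ∀ x e, fderiv ℝ N x e ∈ Submodule.span ℝ {F x, pd du F x, pd dv F x, w}

/-- the chart coordinates `(u,v)` are conformal curvature line coordinates
corresponding to `η`, with conformal factor `e^{2θ}`:
`I = e^{2θ}(du² + dv²)` and `η = e^{−2θ} F ∧ (−F_u du + F_v dv)`. -/
def ConformalCoords (n : ℕ) (S : IsothermicSurface n) (θ : Surf → ℝ) : Prop :=
  ContDiff ℝ (⊤ : ℕ∞) θ
  ∧ (∀ x, mink n (pd du S.F x) (pd du S.F x) = Real.exp (2 * θ x))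
  ∧ (∀ x, mink n (pd dv S.F x) (pd dv S.F x) = Real.exp (2 * θ x))
  ∧ (∀ x, mink n (pd du S.F x) (pd dv S.F x) = 0)
  ∧ (∀ x z, wedge n (S.F x) (S.W₁ x) z
      = Real.exp (-(2 * θ x)) • wedge n (S.F x) (-pd du S.F x) z)
  ∧ (∀ x z, wedge n (S.F x) (S.W₂ x) z
      = Real.exp (-(2 * θ x)) • wedge n (S.F x) (pd dv S.F x) z)

/-- the second fundamental form of the lift `F` in `E(w)` with respect to the
unit normal `N` is `II = e^{2θ}(k₁ du² + k₂ dv²)`. -/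
def PrincipalCurvatures (n : ℕ) (S : IsothermicSurface n) (N : Surf → MV n)
    (θ k₁ k₂ : Surf → ℝ) : Prop :=
  (∀ x, mink n (pd du (pd du S.F) x) (N x) = Real.exp (2 * θ x) * k₁ x)
  ∧ (∀ x, mink n (pd du (pd dv S.F) x) (N x) = 0)
  ∧ (∀ x, mink n (pd dv (pd dv S.F) x) (N x) = Real.exp (2 * θ x) * k₂ x)

/-- partial derivative of a real function on the surface -/
def pdR (e : Surf) (f : Surf → ℝ) (x : Surf) : ℝ := fderiv ℝ f x e
/-- `(Λ^c, η^c)` is the Christoffel transform of `(Λ,η)` with respect to the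
pair `(v∞, v₀)`, witnessed by the stereoprojections `f`, `f^c` into
`ℝ^n = ⟨v₀,v∞⟩^⊥`:  `F = exp(f ∧ v∞)v₀`, `F^c = exp(f^c ∧ v₀)v∞`,
`η = Ad(exp(f ∧ v∞))(df^c ∧ v₀)` and `η^c = Ad(exp(f^c ∧ v₀))(df ∧ v∞)`. -/
def IsChristoffelPair (n : ℕ) (S Sc : IsothermicSurface n) (vinf v0 : MV n)
    (f fc : Surf → MV n) : Prop :=
  vinf ∈ LightCone n ∧ v0 ∈ LightCone n ∧ mink n v0 vinf = -1
  ∧ ContDiff ℝ (⊤ : ℕ∞) f ∧ ContDiff ℝ (⊤ : ℕ∞) fc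
  ∧ (∀ x, mink n (f x) v0 = 0) ∧ (∀ x, mink n (f x) vinf = 0)
  ∧ (∀ x, mink n (fc x) v0 = 0) ∧ (∀ x, mink n (fc x) vinf = 0)
  ∧ (∀ x, S.F x = v0 + f x + (mink n (f x) (f x) / 2) • vinf)
  ∧ (∀ x, Sc.F x = vinf + fc x + (mink n (fc x) (fc x) / 2) • v0)
  ∧ (∀ x z, wedge n (S.F x) (S.W₁ x) z
      = wedge n (pd du fc x + mink n (f x) (pd du fc x) • vinf) (S.F x) z)
  ∧ (∀ x z, wedge n (S.F x) (S.W₂ x) z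
      = wedge n (pd dv fc x + mink n (f x) (pd dv fc x) • vinf) (S.F x) z)
  ∧ (∀ x z, wedge n (Sc.F x) (Sc.W₁ x) z
      = wedge n (pd du f x + mink n (fc x) (pd du f x) • v0) (Sc.F x) z)
  ∧ (∀ x z, wedge n (Sc.F x) (Sc.W₂ x) z
      = wedge n (pd dv f x + mink n (fc x) (pd dv f x) • v0) (Sc.F x) z)

/-- `Φ` is an orthogonal gauge transformation with `Φ · (d + sη) = d`. -/
def IsTGauge (n : ℕ) (S : IsothermicSurface n) (s : ℝ)
    (Φ : Surf → MV n → MV n) : Prop :=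
  (∀ x, IsLinearMap ℝ (Φ x))
  ∧ (∀ x z z', mink n (Φ x z) (Φ x z') = mink n z z')
  ∧ (∀ σ : Surf → MV n, ContDiff ℝ (⊤ : ℕ∞) σ → ∀ x,
      (fderiv ℝ (fun y => Φ y (σ y)) x du
         = Φ x (fderiv ℝ σ x du + s • wedge n (S.F x) (S.W₁ x) (σ x)))
      ∧ (fderiv ℝ (fun y => Φ y (σ y)) x dv
         = Φ x (fderiv ℝ σ x dv + s • wedge n (S.F x) (S.W₂ x) (σ x))))

/-- `(Λ_s, η_s)` is the T-transform of `(Λ,η)` associated to `Φ_s`: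
`Λ_s = Φ_s Λ` and `η_s = Ad(Φ_s) η`. -/
def IsTTransform (n : ℕ) (S : IsothermicSurface n) (s : ℝ)
    (Φ : Surf → MV n → MV n) (Ss : IsothermicSurface n) : Prop :=
  IsTGauge n S s Φ
  ∧ (∀ x, Ss.F x = Φ x (S.F x))
  ∧ (∀ x z, wedge n (Ss.F x) (Ss.W₁ x) (Φ x z) = Φ x (wedge n (S.F x) (S.W₁ x) z))
  ∧ (∀ x z, wedge n (Ss.F x) (Ss.W₂ x) (Φ x z) = Φ x (wedge n (S.F x) (S.W₂ x) z))

/-- orthogonal complement with respect to the Minkowski form -/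
def mperp (n : ℕ) (U : Submodule ℝ (MV n)) : Submodule ℝ (MV n) where
  carrier := {v | ∀ u ∈ U, mink n v u = 0}
  add_mem' := by
    intro a b ha hb u hu
    rw [mink_add_left, ha u hu, hb u hu, add_zero]
  zero_mem' := by
    intro u hu; exact mink_zero_left n u
  smul_mem' := by
    intro r a ha u hu
    rw [mink_smul_left, ha u hu, mul_zero]

/-- the spherical system of `Λ` and a Darboux transform `Λ̂ = ⟨G⟩`: the
`(n−2)`-sphere congruence `C = Λ ⊕ Λ̂ ⊕ V_R^⊥`, `V_R = Λ^{(1)} ⊕ Λ̂`. -/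
def sphericalSystem (n : ℕ) (S : IsothermicSurface n) (G : Surf → MV n)
    (x : Surf) : Submodule ℝ (MV n) :=
  Submodule.span ℝ {S.F x, G x}
    ⊔ mperp n (Submodule.span ℝ {S.F x, pd du S.F x, pd dv S.F x, G x})

/-- the sphere-planes congruence `P = C + ⟨w⟩` of `Λ` and `Λ̂ = ⟨G⟩` with
respect to `w`. -/
def spherePlanes (n : ℕ) (S : IsothermicSurface n) (G : Surf → MV n)
    (w : MV n) (x : Surf) : Submodule ℝ (MV n) :=
  sphericalSystem n S G x ⊔ Submodule.span ℝ {w}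
/-- the mean curvature `H = (k₁+k₂)/2` -/
def Hfun (k₁ k₂ : Surf → ℝ) : Surf → ℝ := fun x => (k₁ x + k₂ x) / 2

/-- `L = e^{2θ}(k₁ − k₂)` -/
def Lfun (θ k₁ k₂ : Surf → ℝ) : Surf → ℝ :=
  fun x => Real.exp (2 * θ x) * (k₁ x - k₂ x)

/-- `M = −HL` -/
def Mfun (θ k₁ k₂ : Surf → ℝ) : Surf → ℝ :=
  fun x => -(Hfun k₁ k₂ x * Lfun θ k₁ k₂ x)
section MinkowskiForm

variable {n : ℕ}

lemma mink_comm (a b : MV n) : mink n a b = mink n b a := by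
  simp [mink, mul_comm]

lemma mink_add_right (a b c : MV n) : mink n a (b + c) = mink n a b + mink n a c := by
  rw [mink_comm, mink_add_left, mink_comm b, mink_comm c]

lemma mink_smul_right (r : ℝ) (a c : MV n) : mink n a (r • c) = r * mink n a c := by
  rw [mink_comm, mink_smul_left, mink_comm c]

lemma mink_neg_left (a c : MV n) : mink n (-a) c = -mink n a c := by
  simpa using mink_smul_left n (-1) a c

lemma mink_neg_right (a c : MV n) : mink n a (-c) = -mink n a c := by
  rw [mink_comm, mink_neg_left, mink_comm c]

lemma mink_sub_left (a b c : MV n) : mink n (a - b) c = mink n a c - mink n b c := by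
  rw [sub_eq_add_neg, mink_add_left, mink_neg_left, sub_eq_add_neg]

lemma mink_zero_right (a : MV n) : mink n a 0 = 0 := by
  rw [mink_comm, mink_zero_left]

/-- The Minkowski form as a continuous bilinear map. -/
def minkL (n : ℕ) : MV n →L[ℝ] MV n →L[ℝ] ℝ :=
  LinearMap.toContinuousBilinearMap
    (LinearMap.mk₂ ℝ (mink n) (mink_add_left n) (mink_smul_left n) mink_add_right mink_smul_right)

lemma minkL_apply (a b : MV n) : minkL n a b = mink n a b := by
  simp [minkL]

/-- The Minkowski form is nondegenerate. -/
lemma eq_zero_of_forall_mink_eq_zero {z : MV n} (h : ∀ y, mink n z y = 0) : z = 0 := by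
  ext i
  refine Fin.lastCases ?_ (fun j => ?_) i
  · have := h (EuclideanSpace.single (Fin.last (n + 1)) 1)
    simpa [mink, (Fin.castSucc_lt_last _).ne] using this
  · have := h (EuclideanSpace.single j.castSucc 1)
    simpa [mink, (Fin.castSucc_lt_last _).ne', Pi.single_apply, Fin.castSucc_inj] using this

end MinkowskiForm

section PartialDerivatives

variable {n : ℕ} {x : Surf} {e : Surf}

lemma pdR_add {f g : Surf → ℝ} (hf : Differentiable ℝ f) (hg : Differentiable ℝ g) :
    pdR e (fun y => f y + g y) x = pdR e f x + pdR e g x := by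
  simp [pdR, fderiv_fun_add (hf x) (hg x)]

lemma pdR_sub {f g : Surf → ℝ} (hf : Differentiable ℝ f) (hg : Differentiable ℝ g) :
    pdR e (fun y => f y - g y) x = pdR e f x - pdR e g x := by
  simp [pdR, fderiv_fun_sub (hf x) (hg x)]

lemma pdR_mul {f g : Surf → ℝ} (hf : Differentiable ℝ f) (hg : Differentiable ℝ g) :
    pdR e (fun y => f y * g y) x = pdR e f x * g x + f x * pdR e g x := by
  simp [pdR, fderiv_fun_mul (hf x) (hg x)]; ring

lemma pdR_neg {f : Surf → ℝ} : pdR e (fun y => -f y) x = -pdR e f x := by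
  simp [pdR, fderiv_fun_neg]

lemma pdR_const (c : ℝ) : pdR e (fun _ => c) x = 0 := by
  simp [pdR]

lemma pdR_const_mul {f : Surf → ℝ} (hf : Differentiable ℝ f) (c : ℝ) :
    pdR e (fun y => c * f y) x = c * pdR e f x := by
  simp [pdR, fderiv_const_mul (hf x)]

lemma pdR_exp_two_mul {f : Surf → ℝ} (hf : Differentiable ℝ f) :
    pdR e (fun y => Real.exp (2 * f y)) x = 2 * Real.exp (2 * f x) * pdR e f x := by
  have h : DifferentiableAt ℝ (fun y => 2 * f y) x := (hf x).const_mul 2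
  simp [pdR, fderiv_exp h, fderiv_const_mul (hf x)]; ring

lemma pdR_mink {f g : Surf → MV n} (hf : Differentiable ℝ f) (hg : Differentiable ℝ g) :
    pdR e (fun y => mink n (f y) (g y)) x = mink n (pd e f x) (g x) + mink n (f x) (pd e g x) := by
  have h := (minkL n).hasFDerivAt_of_bilinear (hf x).hasFDerivAt (hg x).hasFDerivAt
  simp only [minkL_apply] at h
  simp [pdR, pd, h.fderiv, minkL_apply, add_comm]

lemma pd_add {f g : Surf → MV n} (hf : Differentiable ℝ f) (hg : Differentiable ℝ g) :
    pd e (fun y => f y + g y) x = pd e f x + pd e g x := by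
  simp [pd, fderiv_fun_add (hf x) (hg x)]

lemma pd_const (c : MV n) : pd e (fun _ => c) x = 0 := by
  simp [pd]

lemma pd_smul {f : Surf → ℝ} {g : Surf → MV n} (hf : Differentiable ℝ f)
    (hg : Differentiable ℝ g) :
    pd e (fun y => f y • g y) x = pdR e f x • g x + f x • pd e g x := by
  simp [pd, pdR, fderiv_fun_smul (hf x) (hg x), add_comm]

lemma contDiff_pd {f : Surf → MV n} (hf : ContDiff ℝ (⊤ : ℕ∞) f) (e : Surf) :
    ContDiff ℝ (⊤ : ℕ∞) (pd e f) :=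
  (hf.fderiv_right (m := (⊤ : ℕ∞)) (by simp)).clm_apply contDiff_const

lemma contDiff_pdR {f : Surf → ℝ} (hf : ContDiff ℝ (⊤ : ℕ∞) f) (e : Surf) :
    ContDiff ℝ (⊤ : ℕ∞) (pdR e f) :=
  (hf.fderiv_right (m := (⊤ : ℕ∞)) (by simp)).clm_apply contDiff_const

lemma contDiff_smul_fun {f : Surf → ℝ} {g : Surf → MV n} (hf : ContDiff ℝ (⊤ : ℕ∞) f)
    (hg : ContDiff ℝ (⊤ : ℕ∞) g) : ContDiff ℝ (⊤ : ℕ∞) (fun x => f x • g x) :=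
  hf.smul hg

lemma contDiff_add_fun {f g : Surf → MV n} (hf : ContDiff ℝ (⊤ : ℕ∞) f)
    (hg : ContDiff ℝ (⊤ : ℕ∞) g) : ContDiff ℝ (⊤ : ℕ∞) (fun x => f x + g x) :=
  hf.add hg

lemma contDiff_mink {f g : Surf → MV n} (hf : ContDiff ℝ (⊤ : ℕ∞) f)
    (hg : ContDiff ℝ (⊤ : ℕ∞) g) : ContDiff ℝ (⊤ : ℕ∞) (fun x => mink n (f x) (g x)) := by
  simp only [← minkL_apply]
  exact ((minkL n).contDiff.comp hf).clm_apply hg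

lemma fderiv_fderiv_apply_comm {V : Type*} [NormedAddCommGroup V] [NormedSpace ℝ V]
    {f : Surf → V} (hf : ContDiff ℝ (⊤ : ℕ∞) f) (x a b : Surf) :
    fderiv ℝ (fun y => fderiv ℝ f y a) x b = fderiv ℝ (fun y => fderiv ℝ f y b) x a := by
  have hd : DifferentiableAt ℝ (fderiv ℝ f) x :=
    (hf.fderiv_right (m := (⊤ : ℕ∞)) (by simp)).differentiable (by simp) x
  have hs : IsSymmSndFDerivAt ℝ f x := hf.contDiffAt.isSymmSndFDerivAt (by
    rw [minSmoothness_of_isRCLikeNormedField]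
    exact WithTop.coe_le_coe.2 (le_top : (2 : ℕ∞) ≤ ⊤))
  rw [fderiv_clm_apply hd (by fun_prop), fderiv_clm_apply hd (by fun_prop)]
  simpa using hs b a

lemma pd_comm {f : Surf → MV n} (hf : ContDiff ℝ (⊤ : ℕ∞) f) (a b x : Surf) :
    pd a (pd b f) x = pd b (pd a f) x :=
  fderiv_fderiv_apply_comm hf x b a

lemma pdR_comm {f : Surf → ℝ} (hf : ContDiff ℝ (⊤ : ℕ∞) f) (a b x : Surf) :
    pdR a (pdR b f) x = pdR b (pdR a f) x :=
  fderiv_fderiv_apply_comm hf x b a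

lemma exists_eq_const_of_pdR_eq_zero {f : Surf → ℝ} (hf : Differentiable ℝ f)
    (hu : ∀ x, pdR du f x = 0) (hv : ∀ x, pdR dv f x = 0) : ∃ c, ∀ x, f x = c := by
  refine ⟨f 0, fun x => is_const_of_fderiv_eq_zero hf (fun y => ?_) x 0⟩
  ext
  · simpa [pdR, du] using hu y
  · simpa [pdR, dv] using hv y

lemma ContDiff.differentiable_top {V : Type*} [NormedAddCommGroup V] [NormedSpace ℝ V]
    {f : Surf → V} (hf : ContDiff ℝ (⊤ : ℕ∞) f) : Differentiable ℝ f :=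
  hf.differentiable (by simp)

end PartialDerivatives

/-- A smooth null lift `F` into `E(w)` with unit normal `N`, in conformal curvature line
coordinates with conformal factor `e^{2θ}` and principal curvatures `k₁`, `k₂`. -/
structure IsCurvatureLineFrame (F N : Surf → MV 3) (w : MV 3) (θ k₁ k₂ : Surf → ℝ) : Prop where
  smooth_F : ContDiff ℝ (⊤ : ℕ∞) F
  smooth_N : ContDiff ℝ (⊤ : ℕ∞) N
  smooth_θ : ContDiff ℝ (⊤ : ℕ∞) θ
  smooth_k₁ : ContDiff ℝ (⊤ : ℕ∞) k₁
  smooth_k₂ : ContDiff ℝ (⊤ : ℕ∞) k₂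
  F_F : ∀ x, mink 3 (F x) (F x) = 0
  F_w : ∀ x, mink 3 (F x) w = -1
  Fu_Fu : ∀ x, mink 3 (pd du F x) (pd du F x) = Real.exp (2 * θ x)
  Fv_Fv : ∀ x, mink 3 (pd dv F x) (pd dv F x) = Real.exp (2 * θ x)
  Fu_Fv : ∀ x, mink 3 (pd du F x) (pd dv F x) = 0
  N_N : ∀ x, mink 3 (N x) (N x) = 1
  N_w : ∀ x, mink 3 (N x) w = 0
  N_F : ∀ x, mink 3 (N x) (F x) = 0
  N_Fu : ∀ x, mink 3 (N x) (pd du F x) = 0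
  N_Fv : ∀ x, mink 3 (N x) (pd dv F x) = 0
  Fuu_N : ∀ x, mink 3 (pd du (pd du F) x) (N x) = Real.exp (2 * θ x) * k₁ x
  Fuv_N : ∀ x, mink 3 (pd du (pd dv F) x) (N x) = 0
  Fvv_N : ∀ x, mink 3 (pd dv (pd dv F) x) (N x) = Real.exp (2 * θ x) * k₂ x

namespace IsCurvatureLineFrame

variable {F N : Surf → MV 3} {w : MV 3} {θ k₁ k₂ : Surf → ℝ}
  (h : IsCurvatureLineFrame F N w θ k₁ k₂)
include h

lemma F_pd (e x : Surf) : mink 3 (F x) (pd e F x) = 0 := by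
  have h1 : pdR e (fun y => mink 3 (F y) (F y)) x = 0 := by
    simp only [h.F_F, pdR_const]
  rw [pdR_mink h.smooth_F.differentiable_top h.smooth_F.differentiable_top,
    mink_comm (pd e F x)] at h1
  linarith

lemma pd_w (e x : Surf) : mink 3 (pd e F x) w = 0 := by
  have h1 : pdR e (fun y => mink 3 (F y) w) x = 0 := by
    simp only [h.F_w, pdR_const]
  rwa [pdR_mink h.smooth_F.differentiable_top (differentiable_const w), pd_const,
    mink_zero_right, add_zero] at h1

lemma eq_of_mink_eq {x : Surf} {a b : MV 3} (h1 : mink 3 a (F x) = mink 3 b (F x))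
    (h2 : mink 3 a (pd du F x) = mink 3 b (pd du F x))
    (h3 : mink 3 a (pd dv F x) = mink 3 b (pd dv F x))
    (h4 : mink 3 a (N x) = mink 3 b (N x)) (h5 : mink 3 a w = mink 3 b w) : a = b := by
  have hE := Real.exp_pos (2 * θ x)
  let f : Fin 5 → MV 3 := ![F x, pd du F x, pd dv F x, N x, w]
  have hf : LinearIndependent ℝ f := by
    rw [Fintype.linearIndependent_iff]
    intro g hg
    have key : ∀ z, g 0 * mink 3 (F x) z + g 1 * mink 3 (pd du F x) z
        + g 2 * mink 3 (pd dv F x) z + g 3 * mink 3 (N x) z + g 4 * mink 3 w z = 0 := by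
      intro z
      have := congrArg (fun y => mink 3 y z) hg
      simpa [f, Fin.sum_univ_five, mink_add_left, mink_smul_left, mink_zero_left] using this
    have e1 := key (F x)
    have e2 := key (pd du F x)
    have e3 := key (pd dv F x)
    have e4 := key (N x)
    have e5 := key w
    simp only [h.F_F, h.F_pd, h.F_w, h.N_F, h.N_Fu, h.N_Fv, h.N_N, h.N_w, h.pd_w, h.Fu_Fu, h.Fv_Fv,
      h.Fu_Fv, mink_comm w (F x), mink_comm w (pd _ F x), mink_comm w (N x),
      mink_comm (pd _ F x) (F x), mink_comm (pd _ F x) (N x), mink_comm (F x) (N x),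
      mink_comm (pd dv F x) (pd du F x)] at e1 e2 e3 e4 e5
    have g4 : g 4 = 0 := by linarith
    have g1 : g 1 = 0 := by
      rcases mul_eq_zero.mp (show g 1 * Real.exp (2 * θ x) = 0 by linarith) with h | h
      · exact h
      · exact absurd h hE.ne'
    have g2 : g 2 = 0 := by
      rcases mul_eq_zero.mp (show g 2 * Real.exp (2 * θ x) = 0 by linarith) with h | h
      · exact h
      · exact absurd h hE.ne'
    have g3 : g 3 = 0 := by linarith
    have g0 : g 0 = 0 := by rw [g4] at e5; linarith
    intro i
    fin_cases i <;> assumption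
  have hspan : Submodule.span ℝ (Set.range f) = ⊤ :=
    hf.span_eq_top_of_card_eq_finrank (by simp)
  rw [← sub_eq_zero]
  refine eq_zero_of_forall_mink_eq_zero fun y => ?_
  have hy : y ∈ Submodule.span ℝ (Set.range f) := hspan ▸ Submodule.mem_top
  induction hy using Submodule.span_induction with
  | mem y hy =>
    obtain ⟨i, rfl⟩ := hy
    rw [mink_sub_left, sub_eq_zero]
    fin_cases i <;> assumption
  | zero => exact mink_zero_right _
  | add y z _ _ hy hz => rw [mink_add_right, hy, hz, add_zero]
  | smul r y _ hy => rw [mink_smul_right, hy, mul_zero]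

omit h in
lemma pdR_mink_pd (hF : ContDiff ℝ (⊤ : ℕ∞) F) (a b c x : Surf) :
    pdR a (fun y => mink 3 (pd b F y) (pd c F y)) x
      = mink 3 (pd a (pd b F) x) (pd c F x) + mink 3 (pd a (pd c F) x) (pd b F x) := by
  rw [pdR_mink (contDiff_pd hF b).differentiable_top (contDiff_pd hF c).differentiable_top,
    mink_comm (pd b F x)]

lemma pd_pd_F (a b x : Surf) :
    mink 3 (pd a (pd b F) x) (F x) = -mink 3 (pd b F x) (pd a F x) := by
  have h1 : pdR a (fun y => mink 3 (F y) (pd b F y)) x = 0 := by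
    simp only [h.F_pd, pdR_const]
  rw [pdR_mink h.smooth_F.differentiable_top (contDiff_pd h.smooth_F b).differentiable_top,
    mink_comm (pd a F x), mink_comm (F x)] at h1
  linarith

lemma pd_pd_w (a b x : Surf) : mink 3 (pd a (pd b F) x) w = 0 := by
  have h1 : pdR a (fun y => mink 3 (pd b F y) w) x = 0 := by
    simp only [h.pd_w, pdR_const]
  rwa [pdR_mink (contDiff_pd h.smooth_F b).differentiable_top (differentiable_const w), pd_const,
    mink_zero_right, add_zero] at h1

lemma pd_Fu_Fu (e x : Surf) :
    mink 3 (pd e (pd du F) x) (pd du F x) = Real.exp (2 * θ x) * pdR e θ x := by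
  have h1 := pdR_mink_pd h.smooth_F e du du x
  simp only [h.Fu_Fu, pdR_exp_two_mul h.smooth_θ.differentiable_top] at h1
  linarith

lemma pd_Fv_Fv (e x : Surf) :
    mink 3 (pd e (pd dv F) x) (pd dv F x) = Real.exp (2 * θ x) * pdR e θ x := by
  have h1 := pdR_mink_pd h.smooth_F e dv dv x
  simp only [h.Fv_Fv, pdR_exp_two_mul h.smooth_θ.differentiable_top] at h1
  linarith

lemma pd_Fu_Fv (e x : Surf) :
    mink 3 (pd e (pd du F) x) (pd dv F x) = -mink 3 (pd e (pd dv F) x) (pd du F x) := by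
  have h1 := pdR_mink_pd h.smooth_F e du dv x
  simp only [h.Fu_Fv, pdR_const] at h1
  linarith

lemma Fuv_Fu (x : Surf) :
    mink 3 (pd du (pd dv F) x) (pd du F x) = Real.exp (2 * θ x) * pdR dv θ x := by
  rw [pd_comm h.smooth_F, h.pd_Fu_Fu]

lemma Fuv_Fv (x : Surf) :
    mink 3 (pd du (pd dv F) x) (pd dv F x) = Real.exp (2 * θ x) * pdR du θ x :=
  h.pd_Fv_Fv du x

lemma Fuu_Fv (x : Surf) :
    mink 3 (pd du (pd du F) x) (pd dv F x) = -(Real.exp (2 * θ x) * pdR dv θ x) := by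
  rw [h.pd_Fu_Fv, h.Fuv_Fu]

lemma Fvv_Fu (x : Surf) :
    mink 3 (pd dv (pd dv F) x) (pd du F x) = -(Real.exp (2 * θ x) * pdR du θ x) := by
  have h1 := h.pd_Fu_Fv dv x
  rw [pd_comm h.smooth_F dv du, h.Fuv_Fv] at h1
  linarith

lemma Fuu_eq (x : Surf) :
    pd du (pd du F) x = (Real.exp (2 * θ x) * mink 3 w w) • F x + pdR du θ x • pd du F x
      + (-pdR dv θ x) • pd dv F x + (Real.exp (2 * θ x) * k₁ x) • N x
      + Real.exp (2 * θ x) • w := by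
  apply h.eq_of_mink_eq (x := x) <;>
    simp only [mink_add_left, mink_smul_left, h.F_F, h.F_pd, h.F_w, h.N_F, h.N_Fu, h.N_Fv, h.N_N,
      h.N_w, h.pd_w, h.Fu_Fu, h.Fv_Fv, h.Fu_Fv, mink_comm w (F x), mink_comm w (pd _ F x),
      mink_comm w (N x), mink_comm (pd _ F x) (F x), mink_comm (pd _ F x) (N x),
      mink_comm (F x) (N x), mink_comm (pd dv F x) (pd du F x), h.pd_pd_F, h.pd_pd_w, h.Fuu_N,
      h.pd_Fu_Fu, h.Fuu_Fv] <;> ring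

lemma Fuv_eq (x : Surf) :
    pd du (pd dv F) x = pdR dv θ x • pd du F x + pdR du θ x • pd dv F x := by
  apply h.eq_of_mink_eq (x := x) <;>
    simp only [mink_add_left, mink_smul_left, h.F_pd, h.N_Fu, h.N_Fv, h.pd_w, h.Fu_Fu, h.Fv_Fv,
      h.Fu_Fv, mink_comm (pd _ F x) (F x), mink_comm (pd _ F x) (N x),
      mink_comm (pd dv F x) (pd du F x), h.pd_pd_F, h.pd_pd_w, h.Fuv_N, h.Fuv_Fu, h.Fuv_Fv] <;>
    ring

lemma Fvv_eq (x : Surf) :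
    pd dv (pd dv F) x = (Real.exp (2 * θ x) * mink 3 w w) • F x + (-pdR du θ x) • pd du F x
      + pdR dv θ x • pd dv F x + (Real.exp (2 * θ x) * k₂ x) • N x
      + Real.exp (2 * θ x) • w := by
  apply h.eq_of_mink_eq (x := x) <;>
    simp only [mink_add_left, mink_smul_left, h.F_F, h.F_pd, h.F_w, h.N_F, h.N_Fu, h.N_Fv, h.N_N,
      h.N_w, h.pd_w, h.Fu_Fu, h.Fv_Fv, h.Fu_Fv, mink_comm w (F x), mink_comm w (pd _ F x),
      mink_comm w (N x), mink_comm (pd _ F x) (F x), mink_comm (pd _ F x) (N x),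
      mink_comm (F x) (N x), mink_comm (pd dv F x) (pd du F x), h.pd_pd_F, h.pd_pd_w, h.Fvv_N,
      h.pd_Fv_Fv, h.Fvv_Fu] <;> ring

lemma pd_N_N (e x : Surf) : mink 3 (pd e N x) (N x) = 0 := by
  have h1 : pdR e (fun y => mink 3 (N y) (N y)) x = 0 := by
    simp only [h.N_N, pdR_const]
  rw [pdR_mink h.smooth_N.differentiable_top h.smooth_N.differentiable_top,
    mink_comm (N x)] at h1
  linarith

lemma pd_N_w (e x : Surf) : mink 3 (pd e N x) w = 0 := by
  have h1 : pdR e (fun y => mink 3 (N y) w) x = 0 := by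
    simp only [h.N_w, pdR_const]
  rwa [pdR_mink h.smooth_N.differentiable_top (differentiable_const w), pd_const,
    mink_zero_right, add_zero] at h1

lemma N_pd {e : Surf} (he : e = du ∨ e = dv) (x : Surf) : mink 3 (N x) (pd e F x) = 0 := by
  rcases he with rfl | rfl
  exacts [h.N_Fu x, h.N_Fv x]

lemma pd_N_F {e : Surf} (he : e = du ∨ e = dv) (x : Surf) : mink 3 (pd e N x) (F x) = 0 := by
  have h1 : pdR e (fun y => mink 3 (N y) (F y)) x = 0 := by
    simp only [h.N_F, pdR_const]
  rwa [pdR_mink h.smooth_N.differentiable_top h.smooth_F.differentiable_top, h.N_pd he,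
    add_zero] at h1

lemma pd_N_pd (e : Surf) {a : Surf} (ha : a = du ∨ a = dv) (x : Surf) :
    mink 3 (pd e N x) (pd a F x) = -mink 3 (pd e (pd a F) x) (N x) := by
  have h1 : pdR e (fun y => mink 3 (N y) (pd a F y)) x = 0 := by
    simp only [h.N_pd ha, pdR_const]
  rw [pdR_mink h.smooth_N.differentiable_top (contDiff_pd h.smooth_F a).differentiable_top,
    mink_comm (N x)] at h1
  linarith

lemma Nu_eq (x : Surf) : pd du N x = (-k₁ x) • pd du F x := by
  apply h.eq_of_mink_eq (x := x) <;>
    simp only [mink_smul_left, h.pd_N_N, h.pd_N_w, h.pd_N_F (.inl rfl), h.pd_N_pd du (.inl rfl),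
      h.pd_N_pd du (.inr rfl), h.Fuu_N, h.Fuv_N, mink_comm (pd _ F x) (F x),
      mink_comm (pd _ F x) (N x), h.F_pd, h.N_Fu, h.pd_w, h.Fu_Fu, h.Fu_Fv] <;> ring

lemma Nv_eq (x : Surf) : pd dv N x = (-k₂ x) • pd dv F x := by
  apply h.eq_of_mink_eq (x := x) <;>
    simp only [mink_smul_left, h.pd_N_N, h.pd_N_w, h.pd_N_F (.inr rfl), h.pd_N_pd dv (.inl rfl),
      h.pd_N_pd dv (.inr rfl), pd_comm h.smooth_F dv du, h.Fvv_N, h.Fuv_N,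
      mink_comm (pd _ F x) (F x), mink_comm (pd dv F x) (pd du F x),
      mink_comm (pd _ F x) (N x), h.F_pd, h.N_Fv, h.pd_w, h.Fv_Fv, h.Fu_Fv] <;> ring

/-- The Codazzi equations. -/
lemma codazzi (x : Surf) :
    pdR dv k₁ x = (k₂ x - k₁ x) * pdR dv θ x ∧ pdR du k₂ x = (k₁ x - k₂ x) * pdR du θ x := by
  have hE := Real.exp_pos (2 * θ x)
  have h1 : pd dv (pd du N) x = pd du (pd dv N) x := pd_comm h.smooth_N dv du x
  rw [funext h.Nu_eq, funext h.Nv_eq,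
    pd_smul (f := fun y => -k₁ y) h.smooth_k₁.differentiable_top.neg
      (contDiff_pd h.smooth_F du).differentiable_top,
    pd_smul (f := fun y => -k₂ y) h.smooth_k₂.differentiable_top.neg
      (contDiff_pd h.smooth_F dv).differentiable_top,
    pd_comm h.smooth_F dv du, h.Fuv_eq, pdR_neg, pdR_neg] at h1
  have h2 := congrArg (fun y => mink 3 y (pd du F x)) h1
  have h3 := congrArg (fun y => mink 3 y (pd dv F x)) h1
  simp only [mink_add_left, mink_smul_left, h.Fu_Fu, h.Fu_Fv, h.Fv_Fv,
    mink_comm (pd dv F x) (pd du F x)] at h2 h3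
  constructor
  · apply mul_right_cancel₀ hE.ne'; linarith
  · apply mul_right_cancel₀ hE.ne'; linarith

lemma smooth_H : ContDiff ℝ (⊤ : ℕ∞) (Hfun k₁ k₂) :=
  (h.smooth_k₁.add h.smooth_k₂).div_const 2

lemma smooth_L : ContDiff ℝ (⊤ : ℕ∞) (Lfun θ k₁ k₂) :=
  (Real.contDiff_exp.comp (contDiff_const.mul h.smooth_θ)).mul (h.smooth_k₁.sub h.smooth_k₂)

lemma smooth_M : ContDiff ℝ (⊤ : ℕ∞) (Mfun θ k₁ k₂) :=
  (h.smooth_H.mul h.smooth_L).neg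

lemma differentiable_exp : Differentiable ℝ (fun x => Real.exp (2 * θ x)) :=
  (h.smooth_θ.differentiable_top.const_mul 2).exp

lemma pdR_H (e x : Surf) : pdR e (Hfun k₁ k₂) x = (pdR e k₁ x + pdR e k₂ x) / 2 := by
  have : Hfun k₁ k₂ = fun y => (1 / 2) * (k₁ y + k₂ y) := by ext y; simp [Hfun]; ring
  rw [this, pdR_const_mul (h.smooth_k₁.add h.smooth_k₂).differentiable_top,
    pdR_add h.smooth_k₁.differentiable_top h.smooth_k₂.differentiable_top]
  ring

lemma pdR_L (e x : Surf) : pdR e (Lfun θ k₁ k₂) x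
    = Real.exp (2 * θ x) * (2 * pdR e θ x * (k₁ x - k₂ x) + (pdR e k₁ x - pdR e k₂ x)) := by
  unfold Lfun
  rw [pdR_mul h.differentiable_exp (h.smooth_k₁.sub h.smooth_k₂).differentiable_top,
    pdR_exp_two_mul h.smooth_θ.differentiable_top,
    pdR_sub h.smooth_k₁.differentiable_top h.smooth_k₂.differentiable_top]
  ring

lemma Lu_eq (x : Surf) :
    pdR du (Lfun θ k₁ k₂) x = 2 * Real.exp (2 * θ x) * pdR du (Hfun k₁ k₂) x := by
  rw [h.pdR_L, h.pdR_H, (h.codazzi x).2]; ring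

lemma Lv_eq (x : Surf) :
    pdR dv (Lfun θ k₁ k₂) x = -(2 * Real.exp (2 * θ x) * pdR dv (Hfun k₁ k₂) x) := by
  rw [h.pdR_L, h.pdR_H, (h.codazzi x).1]; ring

lemma pdR_M (e x : Surf) : pdR e (Mfun θ k₁ k₂) x = -(pdR e (Hfun k₁ k₂) x * Lfun θ k₁ k₂ x
    + Hfun k₁ k₂ x * pdR e (Lfun θ k₁ k₂) x) := by
  unfold Mfun
  rw [pdR_neg, pdR_mul h.smooth_H.differentiable_top h.smooth_L.differentiable_top]

lemma Mu_eq (x : Surf) : pdR du (Mfun θ k₁ k₂) x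
    = -(2 * Real.exp (2 * θ x) * k₁ x * pdR du (Hfun k₁ k₂) x) := by
  rw [h.pdR_M, h.Lu_eq, Lfun, Hfun]; ring

lemma Mv_eq (x : Surf) : pdR dv (Mfun θ k₁ k₂) x
    = 2 * Real.exp (2 * θ x) * k₂ x * pdR dv (Hfun k₁ k₂) x := by
  rw [h.pdR_M, h.Lv_eq, Lfun, Hfun]; ring

lemma Huv_eq (x : Surf) : pdR du (pdR dv (Hfun k₁ k₂)) x
    = -(pdR du θ x * pdR dv (Hfun k₁ k₂) x) - pdR dv θ x * pdR du (Hfun k₁ k₂) x := by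
  have hE := Real.exp_pos (2 * θ x)
  have h1 := pdR_comm h.smooth_L du dv x
  have hu : pdR du (Lfun θ k₁ k₂)
      = fun y => 2 * (Real.exp (2 * θ y) * pdR du (Hfun k₁ k₂) y) := by
    ext y; rw [h.Lu_eq]; ring
  have hv : pdR dv (Lfun θ k₁ k₂)
      = fun y => (-2) * (Real.exp (2 * θ y) * pdR dv (Hfun k₁ k₂) y) := by
    ext y; rw [h.Lv_eq]; ring
  have dHu := (contDiff_pdR h.smooth_H du).differentiable_top
  have dHv := (contDiff_pdR h.smooth_H dv).differentiable_top
  rw [hu, hv, pdR_const_mul (f := fun y => Real.exp (2 * θ y) * _) (h.differentiable_exp.mul dHu),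
    pdR_const_mul (f := fun y => Real.exp (2 * θ y) * _) (h.differentiable_exp.mul dHv),
    pdR_mul h.differentiable_exp dHu,
    pdR_mul h.differentiable_exp dHv, pdR_exp_two_mul h.smooth_θ.differentiable_top,
    pdR_exp_two_mul h.smooth_θ.differentiable_top, pdR_comm h.smooth_H dv du] at h1
  apply mul_left_cancel₀ hE.ne'
  linarith

omit h in
lemma wedge_neg_pd (x : Surf) (z : MV 3) : wedge 3 (F x) (-pd du F x) z
    = (-mink 3 (F x) z) • pd du F x + mink 3 (pd du F x) z • F x := by
  rw [wedge, mink_neg_left]; module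

/-- The first derivatives of the top coefficient `r` of a quadratic conserved quantity determine
`r` up to scale and three components of the linear coefficient `q`. -/
lemma exists_top_coeff {q r : Surf → MV 3} (hr : ContDiff ℝ (⊤ : ℕ∞) r)
    (hru : ∀ x, pd du r x + Real.exp (-(2 * θ x)) • wedge 3 (F x) (-pd du F x) (q x) = 0)
    (hrv : ∀ x, pd dv r x + Real.exp (-(2 * θ x)) • wedge 3 (F x) (pd dv F x) (q x) = 0)
    (hFr : ∀ x, mink 3 (F x) (r x) = 0) (hFur : ∀ x, mink 3 (pd du F x) (r x) = 0)
    (hFvr : ∀ x, mink 3 (pd dv F x) (r x) = 0) :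
    ∃ β : ℝ, (∀ x, r x = (β * Hfun k₁ k₂ x) • F x + β • N x)
      ∧ (∀ x, mink 3 (F x) (q x) = -(β * Lfun θ k₁ k₂ x / 2))
      ∧ (∀ x, mink 3 (pd du F x) (q x)
          = -(β * (Real.exp (2 * θ x) * pdR du (Hfun k₁ k₂) x)))
      ∧ (∀ x, mink 3 (pd dv F x) (q x)
          = β * (Real.exp (2 * θ x) * pdR dv (Hfun k₁ k₂) x)) := by
  have hEE : ∀ x, Real.exp (-(2 * θ x)) * Real.exp (2 * θ x) = 1 := fun x => by
    rw [← Real.exp_add]; simp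
  have hru' : ∀ x, pd du r x = (Real.exp (-(2 * θ x)) * mink 3 (F x) (q x)) • pd du F x
      + (-(Real.exp (-(2 * θ x)) * mink 3 (pd du F x) (q x))) • F x := fun x => by
    rw [eq_neg_of_add_eq_zero_left (hru x), wedge_neg_pd]; module
  have hrv' : ∀ x, pd dv r x = (-(Real.exp (-(2 * θ x)) * mink 3 (F x) (q x))) • pd dv F x
      + (Real.exp (-(2 * θ x)) * mink 3 (pd dv F x) (q x)) • F x := fun x => by
    rw [eq_neg_of_add_eq_zero_left (hrv x), wedge]; module
  have dr := hr.differentiable_top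
  have dN := h.smooth_N.differentiable_top
  obtain ⟨β, hβ⟩ : ∃ β, ∀ x, mink 3 (N x) (r x) = β := by
    refine exists_eq_const_of_pdR_eq_zero ?_ (fun x => ?_) (fun x => ?_)
    · exact (contDiff_mink h.smooth_N hr).differentiable_top
    · rw [pdR_mink dN dr, h.Nu_eq, hru']
      simp only [mink_smul_left, mink_add_right, mink_smul_right, hFur, h.N_Fu, h.N_F]
      ring
    · rw [pdR_mink dN dr, h.Nv_eq, hrv']
      simp only [mink_smul_left, mink_add_right, mink_smul_right, hFvr, h.N_Fv, h.N_F]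
      ring
  have huu : ∀ x, mink 3 (F x) (q x) + Real.exp (2 * θ x) * (k₁ x * β + mink 3 w (r x)) = 0 := by
    intro x
    have h1 : pdR du (fun y => mink 3 (pd du F y) (r y)) x = 0 := by
      simp only [hFur, pdR_const]
    rw [pdR_mink (contDiff_pd h.smooth_F du).differentiable_top dr, h.Fuu_eq, hru'] at h1
    simp only [mink_add_left, mink_smul_left, mink_add_right, mink_smul_right, hFr, hFur, hFvr,
      hβ, h.Fu_Fu, mink_comm (pd _ F x) (F x), h.F_pd] at h1
    linear_combination h1 - mink 3 (F x) (q x) * hEE x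
  have hvv : ∀ x, -mink 3 (F x) (q x) + Real.exp (2 * θ x) * (k₂ x * β + mink 3 w (r x)) = 0 := by
    intro x
    have h1 : pdR dv (fun y => mink 3 (pd dv F y) (r y)) x = 0 := by
      simp only [hFvr, pdR_const]
    rw [pdR_mink (contDiff_pd h.smooth_F dv).differentiable_top dr, h.Fvv_eq, hrv'] at h1
    simp only [mink_add_left, mink_smul_left, mink_add_right, mink_smul_right, hFr, hFur, hFvr,
      hβ, h.Fv_Fv, mink_comm (pd _ F x) (F x), h.F_pd] at h1
    linear_combination h1 + mink 3 (F x) (q x) * hEE x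
  have hwr : ∀ x, mink 3 w (r x) = -(β * Hfun k₁ k₂ x) := fun x => by
    apply mul_left_cancel₀ (Real.exp_pos (2 * θ x)).ne'
    rw [Hfun]
    linear_combination (huu x + hvv x) / 2
  have hr_eq : ∀ x, r x = (β * Hfun k₁ k₂ x) • F x + β • N x := fun x => by
    apply h.eq_of_mink_eq (x := x) <;>
      simp only [mink_comm (r x), mink_add_left, mink_smul_left, hFr, hFur, hFvr, hβ, hwr, h.F_F,
        h.F_pd, h.F_w, h.N_F, h.N_Fu, h.N_Fv, h.N_N, h.N_w, mink_comm (F x) (N x)] <;> ring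
  have hFw : ∀ e x, mink 3 w (pd e r x) = -(β * pdR e (Hfun k₁ k₂) x) := fun e x => by
    have h1 : pdR e (fun y => mink 3 w (r y)) x = -(β * pdR e (Hfun k₁ k₂) x) := by
      simp only [hwr]
      rw [pdR_neg, pdR_const_mul h.smooth_H.differentiable_top]
    rwa [pdR_mink (differentiable_const w) dr, pd_const, mink_zero_left, zero_add] at h1
  refine ⟨β, hr_eq, fun x => ?_, fun x => ?_, fun x => ?_⟩
  · rw [Lfun]
    linear_combination (huu x - hvv x) / 2
  · have h1 := hFw du x
    rw [hru', mink_comm] at h1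
    simp only [mink_add_left, mink_smul_left, h.pd_w, h.F_w] at h1
    linear_combination Real.exp (2 * θ x) * h1 - mink 3 (pd du F x) (q x) * hEE x
  · have h1 := hFw dv x
    rw [hrv', mink_comm] at h1
    simp only [mink_add_left, mink_smul_left, h.pd_w, h.F_w] at h1
    linear_combination -Real.exp (2 * θ x) * h1 - mink 3 (pd dv F x) (q x) * hEE x

/-- The linear coefficient `q` of a quadratic conserved quantity forces the second order equations
on the mean curvature. -/
lemma exists_second_order_eqs {q : Surf → MV 3} {β c : ℝ} (hβ : β ≠ 0)
    (hq : ContDiff ℝ (⊤ : ℕ∞) q)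
    (hqu : ∀ x, pd du q x + Real.exp (-(2 * θ x)) • wedge 3 (F x) (-pd du F x) (c • w) = 0)
    (hqv : ∀ x, pd dv q x + Real.exp (-(2 * θ x)) • wedge 3 (F x) (pd dv F x) (c • w) = 0)
    (hFq : ∀ x, mink 3 (F x) (q x) = -(β * Lfun θ k₁ k₂ x / 2))
    (hFuq : ∀ x, mink 3 (pd du F x) (q x)
      = -(β * (Real.exp (2 * θ x) * pdR du (Hfun k₁ k₂) x)))
    (hFvq : ∀ x, mink 3 (pd dv F x) (q x)
      = β * (Real.exp (2 * θ x) * pdR dv (Hfun k₁ k₂) x)) :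
    ∃ A B C : ℝ, ∀ x : Surf,
        (pdR du (pdR du (Hfun k₁ k₂)) x
            + pdR du θ x * pdR du (Hfun k₁ k₂) x
            - pdR dv θ x * pdR dv (Hfun k₁ k₂) x
            - (1 / 2) * Mfun θ k₁ k₂ x * k₁ x - A * k₁ x
            - B * Real.exp (-(2 * θ x)) + C
            - (1 / 2) * Lfun θ k₁ k₂ x * mink 3 w w = 0)
        ∧ (pdR dv (pdR dv (Hfun k₁ k₂)) x
            - pdR du θ x * pdR du (Hfun k₁ k₂) x
            + pdR dv θ x * pdR dv (Hfun k₁ k₂) x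
            + (1 / 2) * Mfun θ k₁ k₂ x * k₂ x + A * k₂ x
            - B * Real.exp (-(2 * θ x)) - C
            + (1 / 2) * Lfun θ k₁ k₂ x * mink 3 w w = 0) := by
  have hd : ∀ a, β * (a / β) = a := fun a => by field_simp
  have hqu' : ∀ x, pd du q x = (-(c * Real.exp (-(2 * θ x)))) • pd du F x := fun x => by
    rw [eq_neg_of_add_eq_zero_left (hqu x), wedge_neg_pd, mink_smul_right, mink_smul_right, h.F_w,
      h.pd_w]; module
  have hqv' : ∀ x, pd dv q x = (c * Real.exp (-(2 * θ x))) • pd dv F x := fun x => by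
    rw [eq_neg_of_add_eq_zero_left (hqv x), wedge, mink_smul_right, mink_smul_right, h.F_w,
      h.pd_w]; module
  have dq := hq.differentiable_top
  obtain ⟨n, hn⟩ : ∃ n, ∀ x, mink 3 w (q x) = n := by
    refine exists_eq_const_of_pdR_eq_zero ?_ (fun x => ?_) (fun x => ?_)
    · exact (contDiff_mink contDiff_const hq).differentiable_top
    · rw [pdR_mink (differentiable_const w) dq, pd_const, hqu', mink_zero_left, mink_smul_right,
        mink_comm w, h.pd_w]; ring
    · rw [pdR_mink (differentiable_const w) dq, pd_const, hqv', mink_zero_left, mink_smul_right,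
        mink_comm w, h.pd_w]; ring
  have dNq := (contDiff_mink h.smooth_N hq).differentiable_top
  have dM := h.smooth_M.differentiable_top
  obtain ⟨m, hm⟩ : ∃ m, ∀ x, mink 3 (N x) (q x) + β / 2 * Mfun θ k₁ k₂ x = m := by
    refine exists_eq_const_of_pdR_eq_zero (dNq.add (dM.const_mul _)) (fun x => ?_) (fun x => ?_)
    · rw [pdR_add dNq (dM.const_mul _), pdR_const_mul dM,
        pdR_mink h.smooth_N.differentiable_top dq, h.Nu_eq, hqu', h.Mu_eq, mink_smul_left,
        mink_smul_right, hFuq, h.N_Fu]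
      ring
    · rw [pdR_add dNq (dM.const_mul _), pdR_const_mul dM,
        pdR_mink h.smooth_N.differentiable_top dq, h.Nv_eq, hqv', h.Mv_eq, mink_smul_left,
        mink_smul_right, hFvq, h.N_Fv]
      ring
  have hm' : ∀ x, mink 3 (N x) (q x) = m - β / 2 * Mfun θ k₁ k₂ x :=
    fun x => eq_sub_of_add_eq (hm x)
  refine ⟨-(m / β), c / β, n / β, fun x => ⟨?_, ?_⟩⟩
  · have dH := (contDiff_pdR h.smooth_H du).differentiable_top
    have h1 : pdR du (fun y => mink 3 (pd du F y) (q y)) x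
        = -(β * (2 * Real.exp (2 * θ x) * pdR du θ x * pdR du (Hfun k₁ k₂) x
          + Real.exp (2 * θ x) * pdR du (pdR du (Hfun k₁ k₂)) x)) := by
      simp only [hFuq]
      rw [pdR_neg, pdR_const_mul (f := fun y => Real.exp (2 * θ y) * _)
        (h.differentiable_exp.mul dH), pdR_mul h.differentiable_exp dH,
        pdR_exp_two_mul h.smooth_θ.differentiable_top]
    rw [pdR_mink (contDiff_pd h.smooth_F du).differentiable_top dq, h.Fuu_eq, hqu'] at h1
    simp only [mink_add_left, mink_smul_left, mink_smul_right, hFq, hFuq, hFvq, hn, hm',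
      h.Fu_Fu] at h1
    apply mul_left_cancel₀ hβ
    apply mul_left_cancel₀ (Real.exp_pos (2 * θ x)).ne'
    linear_combination h1 + Real.exp (2 * θ x) * (k₁ x * hd m - Real.exp (-(2 * θ x)) * hd c + hd n)
  · have dH := (contDiff_pdR h.smooth_H dv).differentiable_top
    have h1 : pdR dv (fun y => mink 3 (pd dv F y) (q y)) x
        = β * (2 * Real.exp (2 * θ x) * pdR dv θ x * pdR dv (Hfun k₁ k₂) x
          + Real.exp (2 * θ x) * pdR dv (pdR dv (Hfun k₁ k₂)) x) := by
      simp only [hFvq]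
      rw [pdR_const_mul (f := fun y => Real.exp (2 * θ y) * _)
        (h.differentiable_exp.mul dH), pdR_mul h.differentiable_exp dH,
        pdR_exp_two_mul h.smooth_θ.differentiable_top]
    rw [pdR_mink (contDiff_pd h.smooth_F dv).differentiable_top dq, h.Fvv_eq, hqv'] at h1
    simp only [mink_add_left, mink_smul_left, mink_smul_right, hFq, hFuq, hFvq, hn, hm',
      h.Fv_Fv] at h1
    apply mul_left_cancel₀ hβ
    apply mul_left_cancel₀ (Real.exp_pos (2 * θ x)).ne'
    linear_combination -h1 - Real.exp (2 * θ x) * (k₂ x * hd m + Real.exp (-(2 * θ x)) * hd c + hd n)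

/-- The second order equations yield a quadratic conserved quantity
`B w + t q + t² (H F + N)`, where `q` has the components below in the frame. -/
lemma exists_linear_coeff {A B C : ℝ} (heq : ∀ x : Surf,
        (pdR du (pdR du (Hfun k₁ k₂)) x
            + pdR du θ x * pdR du (Hfun k₁ k₂) x
            - pdR dv θ x * pdR dv (Hfun k₁ k₂) x
            - (1 / 2) * Mfun θ k₁ k₂ x * k₁ x - A * k₁ x
            - B * Real.exp (-(2 * θ x)) + C
            - (1 / 2) * Lfun θ k₁ k₂ x * mink 3 w w = 0)
        ∧ (pdR dv (pdR dv (Hfun k₁ k₂)) x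
            - pdR du θ x * pdR du (Hfun k₁ k₂) x
            + pdR dv θ x * pdR dv (Hfun k₁ k₂) x
            + (1 / 2) * Mfun θ k₁ k₂ x * k₂ x + A * k₂ x
            - B * Real.exp (-(2 * θ x)) - C
            + (1 / 2) * Lfun θ k₁ k₂ x * mink 3 w w = 0)) :
    ∃ q : Surf → MV 3, ContDiff ℝ (⊤ : ℕ∞) q
      ∧ (∀ x, pd du q x + Real.exp (-(2 * θ x)) • wedge 3 (F x) (-pd du F x) (B • w) = 0)
      ∧ (∀ x, pd dv q x + Real.exp (-(2 * θ x)) • wedge 3 (F x) (pd dv F x) (B • w) = 0)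
      ∧ (∀ x, mink 3 (F x) (q x) = -(Lfun θ k₁ k₂ x / 2))
      ∧ (∀ x, mink 3 (pd du F x) (q x) = -(Real.exp (2 * θ x) * pdR du (Hfun k₁ k₂) x))
      ∧ (∀ x, mink 3 (pd dv F x) (q x) = Real.exp (2 * θ x) * pdR dv (Hfun k₁ k₂) x) := by
  have sF := h.smooth_F
  have sN := h.smooth_N
  have sFu := contDiff_pd h.smooth_F du
  have sFv := contDiff_pd h.smooth_F dv
  have sHu := contDiff_pdR h.smooth_H du
  have sHv := contDiff_pdR h.smooth_H dv
  have sL := h.smooth_L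
  have sM := h.smooth_M
  let a : Surf → ℝ := fun x => mink 3 w w / 2 * Lfun θ k₁ k₂ x - C
  let b : Surf → ℝ := fun x => -pdR du (Hfun k₁ k₂) x
  let m : Surf → ℝ := fun x => (-1 / 2) * Mfun θ k₁ k₂ x - A
  let l : Surf → ℝ := fun x => (1 / 2) * Lfun θ k₁ k₂ x
  have sa : ContDiff ℝ (⊤ : ℕ∞) a := (contDiff_const.mul sL).sub contDiff_const
  have sb : ContDiff ℝ (⊤ : ℕ∞) b := sHu.neg
  have sm : ContDiff ℝ (⊤ : ℕ∞) m := (contDiff_const.mul sM).sub contDiff_const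
  have sl : ContDiff ℝ (⊤ : ℕ∞) l := contDiff_const.mul sL
  have pda : ∀ e x, pdR e a x = mink 3 w w / 2 * pdR e (Lfun θ k₁ k₂) x := fun e x => by
    rw [pdR_sub (sL.differentiable_top.const_mul _) (differentiable_const C), pdR_const,
      pdR_const_mul sL.differentiable_top, sub_zero]
  have pdm : ∀ e x, pdR e m x = (-1 / 2) * pdR e (Mfun θ k₁ k₂) x := fun e x => by
    rw [pdR_sub (sM.differentiable_top.const_mul _) (differentiable_const A), pdR_const,
      pdR_const_mul sM.differentiable_top, sub_zero]
  have pdl : ∀ e x, pdR e l x = (1 / 2) * pdR e (Lfun θ k₁ k₂) x := fun e x =>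
    pdR_const_mul sL.differentiable_top _
  have pdb : ∀ e x, pdR e b x = -pdR e (pdR du (Hfun k₁ k₂)) x := fun e x => pdR_neg
  have s1 := contDiff_smul_fun sa sF
  have s2 := contDiff_smul_fun sb sFu
  have s3 := contDiff_smul_fun sHv sFv
  have s4 := contDiff_smul_fun sm sN
  have s5 := contDiff_smul_fun sl (contDiff_const (c := w))
  have s12 := contDiff_add_fun s1 s2
  have s123 := contDiff_add_fun s12 s3
  have s1234 := contDiff_add_fun s123 s4
  have hpd : ∀ e x, pd e (fun x => a x • F x + b x • pd du F x + pdR dv (Hfun k₁ k₂) x • pd dv F x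
      + m x • N x + l x • w) x
      = (pdR e a x • F x + a x • pd e F x) + (pdR e b x • pd du F x + b x • pd e (pd du F) x)
        + (pdR e (pdR dv (Hfun k₁ k₂)) x • pd dv F x
          + pdR dv (Hfun k₁ k₂) x • pd e (pd dv F) x)
        + (pdR e m x • N x + m x • pd e N x) + pdR e l x • w := fun e x => by
    rw [pd_add s1234.differentiable_top s5.differentiable_top,
      pd_add s123.differentiable_top s4.differentiable_top,
      pd_add s12.differentiable_top s3.differentiable_top,
      pd_add s1.differentiable_top s2.differentiable_top,
      pd_smul sa.differentiable_top sF.differentiable_top,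
      pd_smul sb.differentiable_top sFu.differentiable_top,
      pd_smul sHv.differentiable_top sFv.differentiable_top,
      pd_smul sm.differentiable_top sN.differentiable_top,
      pd_smul sl.differentiable_top (differentiable_const w), pd_const, smul_zero, add_zero]
  refine ⟨fun x => a x • F x + b x • pd du F x + pdR dv (Hfun k₁ k₂) x • pd dv F x + m x • N x
    + l x • w, contDiff_add_fun s1234 s5, fun x => ?_, fun x => ?_, fun x => ?_,
    fun x => ?_, fun x => ?_⟩
  · rw [hpd, pda, pdb, pdm, pdl, h.Lu_eq, h.Mu_eq, h.Fuu_eq, h.Fuv_eq, h.Huv_eq, h.Nu_eq,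
      wedge_neg_pd, mink_smul_right, mink_smul_right, h.F_w, h.pd_w]
    simp only [a, b, m]
    match_scalars
    · ring
    · linear_combination -(heq x).1
    · ring
    · ring
    · ring
  · rw [hpd, pda, pdb, pdm, pdl, h.Lv_eq, h.Mv_eq, h.Fvv_eq, pd_comm h.smooth_F dv du, h.Fuv_eq,
      pdR_comm h.smooth_H dv du, h.Huv_eq, h.Nv_eq,
      wedge, mink_smul_right, mink_smul_right, h.F_w, h.pd_w]
    simp only [a, b, m]
    match_scalars
    · ring
    · linear_combination (heq x).2
    · ring
    · ring
    · ring
  · simp only [mink_add_right, mink_smul_right, h.F_F, h.F_pd, h.F_w, mink_comm (F x) (N x), h.N_F,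
      l]
    ring
  · simp only [mink_add_right, mink_smul_right, mink_comm (pd _ F x) (F x), h.F_pd, h.pd_w,
      mink_comm (pd _ F x) (N x), h.N_Fu, h.Fu_Fu, h.Fu_Fv, b]
    ring
  · simp only [mink_add_right, mink_smul_right, mink_comm (pd _ F x) (F x), h.F_pd, h.pd_w,
      mink_comm (pd _ F x) (N x), h.N_Fv, h.Fv_Fv, mink_comm (pd dv F x) (pd du F x), h.Fu_Fv]
    ring

/-- The section `H F + N` is compatible with the components of the linear coefficient. -/
lemma pd_top_coeff {q : Surf → MV 3}
    (hFq : ∀ x, mink 3 (F x) (q x) = -(Lfun θ k₁ k₂ x / 2))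
    (hFuq : ∀ x, mink 3 (pd du F x) (q x) = -(Real.exp (2 * θ x) * pdR du (Hfun k₁ k₂) x))
    (hFvq : ∀ x, mink 3 (pd dv F x) (q x) = Real.exp (2 * θ x) * pdR dv (Hfun k₁ k₂) x)
    (x : Surf) :
    pd du (fun y => Hfun k₁ k₂ y • F y + N y) x
        + Real.exp (-(2 * θ x)) • wedge 3 (F x) (-pd du F x) (q x) = 0
      ∧ pd dv (fun y => Hfun k₁ k₂ y • F y + N y) x
        + Real.exp (-(2 * θ x)) • wedge 3 (F x) (pd dv F x) (q x) = 0 := by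
  have hEE : Real.exp (-(2 * θ x)) * Real.exp (2 * θ x) = 1 := by
    rw [← Real.exp_add]; simp
  have dN := h.smooth_N.differentiable_top
  have dHF := (contDiff_smul_fun h.smooth_H h.smooth_F).differentiable_top
  have dH := h.smooth_H.differentiable_top
  have dF := h.smooth_F.differentiable_top
  constructor
  · rw [pd_add dHF dN, pd_smul dH dF, h.Nu_eq, wedge_neg_pd, hFq, hFuq, Lfun]
    match_scalars
    · linear_combination -pdR du (Hfun k₁ k₂) x * hEE
    · rw [Hfun]
      linear_combination (k₁ x - k₂ x) / 2 * hEE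
  · rw [pd_add dHF dN, pd_smul dH dF, h.Nv_eq, wedge, hFq, hFvq, Lfun]
    match_scalars
    · linear_combination -pdR dv (Hfun k₁ k₂) x * hEE
    · rw [Hfun]
      linear_combination -(k₁ x - k₂ x) / 2 * hEE

lemma mink_eq_zero_of_wedge_eq_zero {x : Surf} {b z : MV 3} (hb : mink 3 b b ≠ 0)
    (hFb : mink 3 (F x) b = 0) (hbw : mink 3 b w = 0) (hz : wedge 3 (F x) b z = 0) :
    mink 3 (F x) z = 0 ∧ mink 3 b z = 0 := by
  have h1 := congrArg (fun y => mink 3 y b) hz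
  have h2 := congrArg (fun y => mink 3 y w) hz
  simp only [wedge, mink_sub_left, mink_smul_left, hFb, hbw, h.F_w, mink_zero_left] at h1 h2
  refine ⟨(mul_eq_zero.1 (show mink 3 (F x) z * mink 3 b b = 0 by linarith)).resolve_right hb, ?_⟩
  linarith

end IsCurvatureLineFrame

section Polynomials

variable {n : ℕ}

lemma wedge_add_right (a b y z : MV n) : wedge n a b (y + z) = wedge n a b y + wedge n a b z := by
  simp only [wedge, mink_add_right]; module

lemma wedge_smul_right (a b : MV n) (r : ℝ) (z : MV n) :
    wedge n a b (r • z) = r • wedge n a b z := by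
  simp only [wedge, mink_smul_right]; module

lemma cubic_eq_zero_iff {a₀ a₁ a₂ a₃ : MV n} :
    (∀ t : ℝ, a₀ + t • a₁ + t ^ 2 • a₂ + t ^ 3 • a₃ = 0)
      ↔ a₀ = 0 ∧ a₁ = 0 ∧ a₂ = 0 ∧ a₃ = 0 := by
  constructor
  · intro h
    have key : ∀ i, a₀ i = 0 ∧ a₁ i = 0 ∧ a₂ i = 0 ∧ a₃ i = 0 := fun i => by
      have hi : ∀ t : ℝ, a₀ i + t * a₁ i + t ^ 2 * a₂ i + t ^ 3 * a₃ i = 0 := fun t => by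
        simpa using congrArg (fun y : MV n => y i) (h t)
      have h0 := hi 0
      have h1 := hi 1
      have h2 := hi (-1)
      have h3 := hi 2
      norm_num at h0 h1 h2 h3
      refine ⟨h0, ?_, ?_, ?_⟩ <;> linarith
    exact ⟨by ext i; exact (key i).1, by ext i; exact (key i).2.1,
      by ext i; exact (key i).2.2.1, by ext i; exact (key i).2.2.2⟩
  · rintro ⟨rfl, rfl, rfl, rfl⟩ t
    simp

lemma quadratic_parallel_iff {c : ℕ → Surf → MV n} (hc : ∀ k, ContDiff ℝ (⊤ : ℕ∞) (c k))
    (a b : MV n) (e x : Surf) :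
    (∀ t : ℝ, fderiv ℝ (fun y => ∑ k ∈ Finset.range (2 + 1), t ^ k • c k y) x e
        + t • wedge n a b (∑ k ∈ Finset.range (2 + 1), t ^ k • c k x) = 0)
      ↔ pd e (c 0) x = 0 ∧ pd e (c 1) x + wedge n a b (c 0 x) = 0
        ∧ pd e (c 2) x + wedge n a b (c 1 x) = 0 ∧ wedge n a b (c 2 x) = 0 := by
  rw [← cubic_eq_zero_iff]
  refine forall_congr' fun t => ?_
  have hd : fderiv ℝ (fun y => ∑ k ∈ Finset.range (2 + 1), t ^ k • c k y) x e
      = ∑ k ∈ Finset.range (2 + 1), t ^ k • pd e (c k) x := by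
    rw [fderiv_fun_sum (A := fun k y => t ^ k • c k y)
      fun k _ => ((hc k).differentiable_top x).const_smul (t ^ k)]
    simp only [_root_.sum_apply, pd]
    refine Finset.sum_congr rfl fun k _ => ?_
    rw [fderiv_fun_const_smul ((hc k).differentiable_top x)]
    rfl
  rw [hd]
  simp only [Finset.sum_range_succ, Finset.sum_range_zero, zero_add, wedge_add_right,
    wedge_smul_right]
  refine Eq.congr_left ?_
  module

end Polynomials

/-- Theorem: an isothermic surface in `S³` is special isothermic of type `2`
in the space-form `E(w)` if and only if there are real constants `A`, `B`, `C`
with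
`H_uu + θ_u H_u − θ_v H_v − ½Mk₁ − Ak₁ − Be^{−2θ} + C − ½L(w,w) = 0` and
`H_vv − θ_u H_u + θ_v H_v + ½Mk₂ + Ak₂ − Be^{−2θ} − C + ½L(w,w) = 0`. -/
theorem special_type_two_iff_second_order_eqs
    (S : IsothermicSurface 3) (w : MV 3) (hw : w ≠ 0)
    (hlift : ∀ x, mink 3 (S.F x) w = -1)
    (θ k₁ k₂ : Surf → ℝ) (hk₁ : ContDiff ℝ (⊤ : ℕ∞) k₁) (hk₂ : ContDiff ℝ (⊤ : ℕ∞) k₂)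
    (N : Surf → MV 3) (hNsm : ContDiff ℝ (⊤ : ℕ∞) N) (hN : IsUnitNormal 3 S.F N w)
    (hcc : ConformalCoords 3 S θ)
    (hpc : PrincipalCurvatures 3 S N θ k₁ k₂) :
    (∃ p : PolyConservedQuantity 3 S 2, InSpaceForm p w) ↔
      ∃ A B C : ℝ, ∀ x : Surf,
        (pdR du (pdR du (Hfun k₁ k₂)) x
            + pdR du θ x * pdR du (Hfun k₁ k₂) x
            - pdR dv θ x * pdR dv (Hfun k₁ k₂) x
            - (1 / 2) * Mfun θ k₁ k₂ x * k₁ x - A * k₁ x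
            - B * Real.exp (-(2 * θ x)) + C
            - (1 / 2) * Lfun θ k₁ k₂ x * mink 3 w w = 0)
        ∧ (pdR dv (pdR dv (Hfun k₁ k₂)) x
            - pdR du θ x * pdR du (Hfun k₁ k₂) x
            + pdR dv θ x * pdR dv (Hfun k₁ k₂) x
            + (1 / 2) * Mfun θ k₁ k₂ x * k₂ x + A * k₂ x
            - B * Real.exp (-(2 * θ x)) - C
            + (1 / 2) * Lfun θ k₁ k₂ x * mink 3 w w = 0) := by
  obtain ⟨hN1, hN2, hN3, hN4, hN5⟩ := hN
  obtain ⟨hθ, hFu, hFv, hFuv, hW₁, hW₂⟩ := hcc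
  obtain ⟨hp1, hp2, hp3⟩ := hpc
  have h : IsCurvatureLineFrame S.F N w θ k₁ k₂ :=
    ⟨S.smooth_F, hNsm, hθ, hk₁, hk₂, S.F_null, hlift, hFu, hFv, hFuv, hN1, hN2, hN3, hN4, hN5,
      hp1, hp2, hp3⟩
  constructor
  · rintro ⟨p, c, hc⟩
    have hu := fun x => (quadratic_parallel_iff p.smooth (S.F x) (S.W₁ x) du x).1
      fun t => (p.conserved t x).1
    have hv := fun x => (quadratic_parallel_iff p.smooth (S.F x) (S.W₂ x) dv x).1
      fun t => (p.conserved t x).2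
    simp only [hW₁, hW₂, hc] at hu hv
    have hru := fun x => h.mink_eq_zero_of_wedge_eq_zero (x := x) (b := -pd du S.F x)
      (by rw [mink_neg_left, mink_neg_right, neg_neg, hFu]; exact (Real.exp_pos _).ne')
      (by rw [mink_neg_right, h.F_pd, neg_zero]) (by rw [mink_neg_left, h.pd_w, neg_zero])
      ((smul_eq_zero_iff_right (Real.exp_pos _).ne').1 (hu x).2.2.2)
    have hrv := fun x => h.mink_eq_zero_of_wedge_eq_zero (x := x) (b := pd dv S.F x)
      (by rw [hFv]; exact (Real.exp_pos _).ne') (h.F_pd _ x) (h.pd_w _ x)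
      ((smul_eq_zero_iff_right (Real.exp_pos _).ne').1 (hv x).2.2.2)
    obtain ⟨β, hr, hFq, hFuq, hFvq⟩ := h.exists_top_coeff (p.smooth 2)
      (fun x => (hu x).2.2.1) (fun x => (hv x).2.2.1) (fun x => (hru x).1)
      (fun x => by simpa [mink_neg_left] using (hru x).2) (fun x => (hrv x).2)
    have hβ : β ≠ 0 := by
      rintro rfl
      refine p.top_ne (funext fun x => ?_)
      simp [hr x]
    exact h.exists_second_order_eqs hβ (p.smooth 1) (fun x => (hu x).2.1)
      (fun x => (hv x).2.1) hFq hFuq hFvq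
  · rintro ⟨A, B, C, heq⟩
    obtain ⟨q, hq, hqu, hqv, hFq, hFuq, hFvq⟩ := h.exists_linear_coeff heq
    have hr := h.pd_top_coeff hFq hFuq hFvq
    let c : ℕ → Surf → MV 3 := fun k => match k with
      | 0 => fun _ => B • w
      | 1 => q
      | 2 => fun x => Hfun k₁ k₂ x • S.F x + N x
      | _ + 3 => 0
    have hc : ∀ k, ContDiff ℝ (⊤ : ℕ∞) (c k) := fun k => match k with
      | 0 => contDiff_const
      | 1 => hq
      | 2 => contDiff_add_fun (contDiff_smul_fun h.smooth_H S.smooth_F) hNsm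
      | _ + 3 => contDiff_const
    refine ⟨⟨c, hc, fun k hk => ?_, fun h0 => ?_, fun t x => ⟨?_, ?_⟩⟩, B, fun x => rfl⟩
    · obtain ⟨j, rfl⟩ : ∃ j, k = j + 3 := ⟨k - 3, by omega⟩
      rfl
    · have h1 : mink 3 (N 0) (Hfun k₁ k₂ 0 • S.F 0 + N 0) = 0 := by
        have : Hfun k₁ k₂ 0 • S.F 0 + N 0 = 0 := congrFun h0 0
        rw [this, mink_zero_right]
      rw [mink_add_right, mink_smul_right, hN3, hN1] at h1
      norm_num at h1
    · refine (quadratic_parallel_iff hc (S.F x) (S.W₁ x) du x).2 ?_ t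
      simp only [hW₁]
      refine ⟨pd_const _, hqu x, (hr x).1, ?_⟩
      simp [c, wedge, mink_neg_left, mink_add_right, mink_smul_right, S.F_null, h.F_pd,
        mink_comm (pd _ S.F x), mink_comm (S.F x) (N x), hN3, hN4]
    · refine (quadratic_parallel_iff hc (S.F x) (S.W₂ x) dv x).2 ?_ t
      simp only [hW₂]
      refine ⟨pd_const _, hqv x, (hr x).2, ?_⟩
      simp [c, wedge, mink_add_left, mink_add_right, mink_smul_left, mink_smul_right, S.F_null,
        h.F_pd, mink_comm (pd dv S.F x), mink_comm (S.F x) (N x), hN3, hN5]
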